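/- Suppose β(θ) = s/(θ + s + c − Σ_{i=1}^K q_i γ_i/(θ + γ_i)) is a rational function whose denominator has K+1 simple real zeros −δ_0 < −δ_1 < ⋯ < −δ_K < 0 (all negative) and whose denominator is increasing between poles. Then β admits a partial fraction decomposition β(θ) = Σ_{j=0}^K R_j/(θ + δ_j) with all residues R_j > 0; consequently β is the Laplace transform of a nonnegative function t ↦ Σ_j R_j e^{-δ_j t}, which is completely monotone. -/

import Mathlib

open MeasureTheory

section helpers
open Polynomial

noncomputable def auxP {K : ℕ} (a : ℝ) (w γ : Fin K → ℝ) : ℝ[X] :=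
  (X + C a) * ∏ i, (X + C (γ i)) - ∑ i, C (w i) * ∏ k ∈ Finset.univ.erase i, (X + C (γ k))

lemma auxP_aeval {K : ℕ} (a : ℝ) (w γ : Fin K → ℝ) {A : Type*} [Field A] [Algebra ℝ A] (z : A)
    (hz : ∀ i, z + algebraMap ℝ A (γ i) ≠ 0) :
    aeval z (auxP a w γ) = (z + algebraMap ℝ A a - ∑ i, algebraMap ℝ A (w i) /
      (z + algebraMap ℝ A (γ i))) * ∏ i, (z + algebraMap ℝ A (γ i)) := by
  simp only [auxP, map_sub, map_mul, map_sum, map_prod, map_add, aeval_X, aeval_C]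
  rw [sub_mul, Finset.sum_mul]
  congr 1
  refine Finset.sum_congr rfl fun i _ => ?_
  rw [← Finset.mul_prod_erase Finset.univ (fun i => z + algebraMap ℝ A (γ i)) (Finset.mem_univ i)]
  have := hz i
  field_simp

lemma auxP_eval {K : ℕ} (a : ℝ) (w γ : Fin K → ℝ) (z : ℝ)
    (hz : ∀ i, z + γ i ≠ 0) :
    eval z (auxP a w γ) = (z + a - ∑ i, w i / (z + γ i)) * ∏ i, (z + γ i) := by
  simpa using auxP_aeval (A := ℝ) a w γ z hz

lemma auxP_pole {K : ℕ} (a : ℝ) (w γ : Fin K → ℝ) (hw : ∀ i, 0 < w i)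
    (hinj : Function.Injective γ) (i : Fin K) : eval (-γ i) (auxP a w γ) ≠ 0 := by
  simp only [auxP, eval_sub, eval_mul, eval_add, eval_X, eval_C, eval_prod, eval_finsetSum]
  rw [Finset.prod_eq_zero (Finset.mem_univ i) (by simp), Finset.sum_eq_single i]
  · rw [mul_zero, zero_sub, neg_ne_zero]
    refine mul_ne_zero (hw i).ne' (Finset.prod_ne_zero_iff.2 fun k hk => ?_)
    have : γ k ≠ γ i := fun h => (Finset.mem_erase.1 hk).1 (hinj h)
    intro h; apply this; linarith
  · intro b _ hb
    rw [Finset.prod_eq_zero (Finset.mem_erase.2 ⟨hb.symm, Finset.mem_univ i⟩) (by simp), mul_zero]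
  · simp

lemma auxQ_monic {ι : Type*} (s : Finset ι) (γ : ι → ℝ) :
    (∏ i ∈ s, (X + C (γ i))).Monic := monic_prod_of_monic _ _ fun i _ => monic_X_add_C _

lemma auxQ_deg {ι : Type*} (s : Finset ι) (γ : ι → ℝ) :
    (∏ i ∈ s, (X + C (γ i))).degree = (s.card : WithBot ℕ) := by
  rw [degree_prod]; simp

lemma auxP_tail {K : ℕ} (w γ : Fin K → ℝ) :
    (∑ i, C (w i) * ∏ k ∈ Finset.univ.erase i, (X + C (γ k))).degree < ((K + 1 : ℕ) : WithBot ℕ) := by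
  refine (degree_sum_le _ _).trans_lt ?_
  rw [Finset.sup_lt_iff (WithBot.bot_lt_coe _)]
  intro i _
  rw [← smul_eq_C_mul]
  refine (degree_smul_le _ _).trans_lt ?_
  rw [auxQ_deg, Nat.cast_lt]
  have := Finset.card_le_univ (Finset.univ.erase i)
  simp only [Fintype.card_fin] at this
  omega

lemma auxP_lead {K : ℕ} (a : ℝ) (γ : Fin K → ℝ) :
    ((X + C a) * ∏ i, (X + C (γ i))).degree = ((K + 1 : ℕ) : WithBot ℕ) := by
  rw [degree_mul, auxQ_deg, degree_X_add_C]; simp [add_comm]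

lemma auxP_monic {K : ℕ} (a : ℝ) (w γ : Fin K → ℝ) : (auxP a w γ).Monic := by
  refine ((monic_X_add_C a).mul (auxQ_monic _ γ)).sub_of_left ?_
  rw [auxP_lead]; exact auxP_tail w γ

lemma auxP_degree {K : ℕ} (a : ℝ) (w γ : Fin K → ℝ) :
    (auxP a w γ).degree = ((K + 1 : ℕ) : WithBot ℕ) := by
  rw [auxP, degree_sub_eq_left_of_degree_lt, auxP_lead]
  rw [auxP_lead]; exact auxP_tail w γ

lemma auxP_deriv {K : ℕ} (a : ℝ) (w γ : Fin K → ℝ) (x : ℝ)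
    (hx : ∀ i, x + γ i ≠ 0) (h0 : x + a - ∑ i, w i / (x + γ i) = 0) :
    eval x (derivative (auxP a w γ)) =
      (1 + ∑ i, w i / (x + γ i) ^ 2) * ∏ i, (x + γ i) := by
  have hG : HasDerivAt (fun z => z + a - ∑ i, w i / (z + γ i))
      (1 + ∑ i, w i / (x + γ i) ^ 2) x := by
    have h1 : HasDerivAt (fun z => ∑ i, w i / (z + γ i)) (∑ i, -(w i / (x + γ i) ^ 2)) x := by
      refine HasDerivAt.fun_sum fun i _ => ?_
      have := (((hasDerivAt_id x).add_const (γ i)).fun_inv (hx i)).const_mul (w i)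
      refine this.congr_deriv ?_
      simp only [id]; ring
    have := ((hasDerivAt_id x).add_const a).sub h1
    refine this.congr_deriv ?_
    rw [Finset.sum_neg_distrib, sub_neg_eq_add]
  have hQ := (∏ i, (X + C (γ i))).hasDerivAt x
  have hm := hG.mul hQ
  rw [h0, zero_mul, add_zero] at hm
  have hP := (auxP a w γ).hasDerivAt x
  have hev : (fun z => eval z (auxP a w γ)) =ᶠ[nhds x]
      ((fun z => z + a - ∑ i, w i / (z + γ i)) * fun z => eval z (∏ i, (X + C (γ i)))) := by
    have : ∀ᶠ z in nhds x, ∀ i, z + γ i ≠ 0 := by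
      rw [Filter.eventually_all]
      intro i
      exact (continuous_id.add continuous_const).continuousAt.eventually_ne (hx i)
    filter_upwards [this] with z hz
    rw [auxP_eval a w γ z hz]
    simp [eval_prod]
  have := hP.unique (hm.congr_of_eventuallyEq hev)
  rw [this]; simp [eval_prod]

lemma aux_gp_pos {K : ℕ} (w γ : Fin K → ℝ) (hw : ∀ i, 0 < w i) (x : ℝ) :
    0 < 1 + ∑ i, w i / (x + γ i) ^ 2 := by
  have : 0 ≤ ∑ i, w i / (x + γ i) ^ 2 :=
    Finset.sum_nonneg fun i _ => div_nonneg (hw i).le (sq_nonneg _)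
  linarith

lemma aux_real {K : ℕ} (a : ℝ) (w γ : Fin K → ℝ) (hw : ∀ i, 0 < w i) (z : ℂ)
    (h0 : z + (a : ℂ) - ∑ i, (w i : ℂ) / (z + (γ i : ℂ)) = 0) : z.im = 0 := by
  have h := congrArg Complex.im h0
  have key : ∀ i, ((w i : ℂ) / (z + (γ i : ℂ))).im
      = - (z.im * (w i / Complex.normSq (z + γ i))) := by
    intro i
    rw [Complex.div_im]; simp; ring
  simp only [Complex.sub_im, Complex.add_im, Complex.ofReal_im, Complex.im_sum, key,
    Complex.zero_im, Finset.sum_neg_distrib, ← Finset.mul_sum] at h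
  have hpos : 0 ≤ ∑ i, w i / Complex.normSq (z + γ i) :=
    Finset.sum_nonneg fun i _ => div_nonneg (hw i).le (Complex.normSq_nonneg _)
  have h2 : z.im * (1 + ∑ i, w i / Complex.normSq (z + γ i)) = 0 := by linarith
  rcases mul_eq_zero.1 h2 with h3 | h3
  · exact h3
  · linarith

lemma aux_root {K : ℕ} (a : ℝ) (w γ : Fin K → ℝ) (hw : ∀ i, 0 < w i)
    (hinj : Function.Injective γ) (z : ℂ) (hz : aeval z (auxP a w γ) = 0) :
    ∃ x : ℝ, z = x ∧ (∀ i, x + γ i ≠ 0) ∧ x + a - ∑ i, w i / (x + γ i) = 0 := by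
  have hne : ∀ i, z + algebraMap ℝ ℂ (γ i) ≠ 0 := by
    intro i hi
    apply auxP_pole a w γ hw hinj i
    have : z = algebraMap ℝ ℂ (-γ i) := by rw [map_neg]; exact eq_neg_of_add_eq_zero_left hi
    rw [this, aeval_algebraMap_apply] at hz
    simpa using hz
  have h := auxP_aeval a w γ z hne
  rw [hz] at h
  have h0 := (mul_eq_zero.1 h.symm).resolve_right (Finset.prod_ne_zero_iff.2 fun i _ => hne i)
  have him := aux_real a w γ hw z h0
  have hzx : z = (z.re : ℂ) := by apply Complex.ext <;> simp [him]
  refine ⟨z.re, hzx, ?_, ?_⟩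
  · intro i hi
    apply hne i
    rw [hzx]
    rw [Complex.coe_algebraMap]
    exact_mod_cast hi
  · rw [hzx] at h0
    simp only [Complex.coe_algebraMap] at h0
    exact_mod_cast h0

lemma aux_all {K : ℕ} (a : ℝ) (w γ : Fin K → ℝ) (hw : ∀ i, 0 < w i)
    (hinj : Function.Injective γ) (d : Fin (K + 1) → ℝ) 
    (hs : ∀ x : ℝ, (∀ i, x + γ i ≠ 0) → x + a - ∑ i, w i / (x + γ i) = 0 → ∃ j, x = d j)
    (j : Fin (K + 1)) :
    (∀ i, d j + γ i ≠ 0) ∧ d j + a - ∑ i, w i / (d j + γ i) = 0 := by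
  classical
  set p : ℂ[X] := (auxP a w γ).map (algebraMap ℝ ℂ) with hp
  have hp0 : p ≠ 0 := ((auxP_monic a w γ).map _).ne_zero
  have hmem : ∀ z ∈ p.roots, aeval z (auxP a w γ) = 0 := by
    intro z hz
    rw [mem_roots hp0, IsRoot.def, hp, eval_map_algebraMap] at hz
    exact hz
  have hcard : p.roots.card = K + 1 := by
    rw [← (IsAlgClosed.splits p).natDegree_eq_card_roots, hp, natDegree_map]
    exact natDegree_eq_of_degree_eq_some (auxP_degree a w γ)
  have hnd : p.roots.Nodup := by
    rw [Multiset.nodup_iff_count_le_one]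
    intro z
    rw [count_roots]
    by_contra hlt
    push Not at hlt
    rw [one_lt_rootMultiplicity_iff_isRoot hp0] at hlt
    obtain ⟨h2, h1⟩ := hlt
    obtain ⟨x, rfl, hx, hx0⟩ := aux_root a w γ hw hinj z (hmem z ((mem_roots hp0).2 h2))
    have hd := auxP_deriv a w γ x hx hx0
    have hne : eval x (derivative (auxP a w γ)) ≠ 0 := by
      rw [hd]
      exact mul_ne_zero (aux_gp_pos w γ hw x).ne' (Finset.prod_ne_zero_iff.2 fun i _ => hx i)
    apply hne
    rw [IsRoot.def, hp, derivative_map, eval_map_algebraMap] at h1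
    have h3 : aeval (algebraMap ℝ ℂ x) (derivative (auxP a w γ)) = 0 := h1
    rw [aeval_algebraMap_apply] at h3
    simpa using h3
  have hsub : p.roots.toFinset ⊆ Finset.univ.image (fun j => (d j : ℂ)) := by
    intro z hz
    obtain ⟨x, rfl, hx, hx0⟩ := aux_root a w γ hw hinj z (hmem z (Multiset.mem_toFinset.1 hz))
    obtain ⟨j, rfl⟩ := hs x hx hx0
    simp
  have heq : p.roots.toFinset = Finset.univ.image (fun j => (d j : ℂ)) := by
    apply Finset.eq_of_subset_of_card_le hsub
    rw [Multiset.toFinset_card_of_nodup hnd, hcard]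
    exact Finset.card_image_le.trans (by simp)
  have hj : (d j : ℂ) ∈ p.roots.toFinset := by rw [heq]; simp
  obtain ⟨x, hxe, hx, hx0⟩ := aux_root a w γ hw hinj _ (hmem _ (Multiset.mem_toFinset.1 hj))
  have : d j = x := by exact_mod_cast hxe
  rw [this]; exact ⟨hx, hx0⟩

lemma aux_pf {K : ℕ} (a : ℝ) (w γ : Fin K → ℝ) (hw : ∀ i, 0 < w i)
    (δ : Fin (K + 1) → ℝ) (hδ : Function.Injective δ)
    (h1 : ∀ j i, -δ j + γ i ≠ 0) (h2 : ∀ j, -δ j + a - ∑ i, w i / (-δ j + γ i) = 0)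
    (x : ℝ) (hx : ∀ i, x + γ i ≠ 0) (hxd : ∀ j, x + δ j ≠ 0) :
    1 / (x + a - ∑ i, w i / (x + γ i)) =
      ∑ j, (1 + ∑ i, w i / (-δ j + γ i) ^ 2)⁻¹ / (x + δ j) := by
  classical
  have hinj : Set.InjOn (fun j => -δ j) ((Finset.univ : Finset (Fin (K+1))) : Set (Fin (K+1))) :=
    fun i _ j _ h => hδ (neg_injective h)
  have hP : auxP a w γ = ∏ j, (X + C (δ j)) := by
    refine eq_of_degree_le_of_eval_index_eq (s := Finset.univ) (v := fun j => -δ j) hinj ?_ ?_ ?_ ?_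
    · rw [auxP_degree]; simp
    · rw [auxP_degree, auxQ_deg]; simp
    · rw [auxP_monic, auxQ_monic]
    · intro j _
      rw [auxP_eval _ _ _ _ (h1 j), h2 j, eval_prod,
        Finset.prod_eq_zero (Finset.mem_univ j) (by simp)]
      simp
  have hQ : ∏ i, (X + C (γ i)) = ∑ j, C (1 + ∑ i, w i / (-δ j + γ i) ^ 2)⁻¹ *
      ∏ k ∈ Finset.univ.erase j, (X + C (δ k)) := by
    refine eq_of_degrees_lt_of_eval_index_eq (s := Finset.univ) (v := fun j => -δ j) hinj ?_ ?_ ?_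
    · rw [auxQ_deg]; simp; norm_cast; omega
    · refine (degree_sum_le _ _).trans_lt ?_
      rw [Finset.sup_lt_iff (WithBot.bot_lt_coe _)]
      intro i _
      rw [← smul_eq_C_mul]
      refine (degree_smul_le _ _).trans_lt ?_
      rw [auxQ_deg, Nat.cast_lt]
      exact Finset.card_erase_lt_of_mem (Finset.mem_univ i)
    · intro j _
      have hd := auxP_deriv a w γ _ (h1 j) (h2 j)
      rw [hP, derivative_prod_finset, eval_finsetSum, Finset.sum_eq_single j] at hd
      · rw [eval_finsetSum, Finset.sum_eq_single j]
        · simp only [derivative_add, derivative_X, derivative_C, add_zero, mul_one] at hd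
          rw [eval_mul, hd, eval_C, inv_mul_cancel_left₀ (aux_gp_pos w γ hw _).ne', eval_prod]
          simp
        · intro b _ hb
          rw [eval_mul, eval_prod, Finset.prod_eq_zero
            (Finset.mem_erase.2 ⟨hb.symm, Finset.mem_univ j⟩) (by simp), mul_zero]
        · simp
      · intro b _ hb
        rw [eval_mul, eval_prod, Finset.prod_eq_zero
            (Finset.mem_erase.2 ⟨hb.symm, Finset.mem_univ j⟩) (by simp), zero_mul]
      · simp
  have hPx := auxP_eval a w γ x hx
  have hQx := congrArg (eval x) hQ
  have hq0 : ∏ i, (x + γ i) ≠ 0 := Finset.prod_ne_zero_iff.2 fun i _ => hx i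
  have hd0 : ∏ j, (x + δ j) ≠ 0 := Finset.prod_ne_zero_iff.2 fun i _ => hxd i
  rw [hP] at hPx
  simp only [eval_prod, eval_add, eval_X, eval_C, eval_finsetSum, eval_mul] at hPx hQx
  have hg0 : x + a - ∑ i, w i / (x + γ i) ≠ 0 := by
    intro h; rw [h, zero_mul] at hPx; exact hd0 hPx
  have : ∑ j, (1 + ∑ i, w i / (-δ j + γ i) ^ 2)⁻¹ / (x + δ j)
      = (∏ i, (x + γ i)) / ∏ j, (x + δ j) := by
    rw [hQx, Finset.sum_div]
    refine Finset.sum_congr rfl fun j _ => ?_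
    rw [← Finset.mul_prod_erase Finset.univ (fun j => x + δ j) (Finset.mem_univ j)]
    have h3 : ∏ k ∈ Finset.univ.erase j, (x + δ k) ≠ 0 :=
      Finset.prod_ne_zero_iff.2 fun i _ => hxd i
    rw [mul_div_mul_right _ _ h3]
  rw [this, hPx]
  field_simp

end helpers

theorem stmt_10 (K : ℕ) (s c : ℝ) (q γ : Fin K → ℝ) (δ : Fin (K + 1) → ℝ)
    (hs : 0 < s) (hq : ∀ i, 0 < q i) (hγ : ∀ i, 0 < γ i)
    (hinj : Function.Injective γ) (hc : c = ∑ i, q i)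
    (g : ℝ → ℝ)
    (hg : ∀ θ, g θ = θ + s + c - ∑ i, q i * γ i / (θ + γ i))
    (hδpos : ∀ j, 0 < δ j)
    (hδord : StrictAnti δ)  -- so that -δ 0 < -δ 1 < ⋯ < -δ K < 0
    (hzero : ∀ j, g (-δ j) = 0)
    (hsimple : ∀ x : ℝ, (∀ i, x ≠ -γ i) → g x = 0 → ∃ j, x = -δ j) :
    ∃ R : Fin (K + 1) → ℝ,
      (∀ j, 0 < R j) ∧
      (∀ θ : ℝ, (∀ i, θ ≠ -γ i) → (∀ j, θ ≠ -δ j) →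
        s / g θ = ∑ j, R j / (θ + δ j)) ∧
      (∀ t : ℝ, 0 ≤ ∑ j, R j * Real.exp (-δ j * t)) ∧
      (∀ θ > (0:ℝ),
        ∫ t in Set.Ioi (0:ℝ), Real.exp (-θ * t) * ∑ j, R j * Real.exp (-δ j * t)
          = s / g θ) ∧
      (∀ (k : ℕ), ∀ t > (0:ℝ),
        0 ≤ (-1 : ℝ) ^ k *
          iteratedDeriv k (fun t => ∑ j, R j * Real.exp (-δ j * t)) t) := by

  have hw : ∀ i, 0 < q i * γ i := fun i => mul_pos (hq i) (hγ i)
  have hg' : ∀ θ, g θ = θ + (s + c) - ∑ i, q i * γ i / (θ + γ i) := fun θ => by rw [hg θ]; ring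
  have hall := aux_all (s + c) (fun i => q i * γ i) γ hw hinj (fun j => -δ j)
    (fun x hx hx0 => hsimple x (fun i h => hx i (by rw [h]; ring)) (by rw [hg']; exact hx0))
  set R : Fin (K + 1) → ℝ := fun j => s * (1 + ∑ i, (q i * γ i) / (-δ j + γ i) ^ 2)⁻¹ with hR
  have hRpos : ∀ j, 0 < R j := fun j =>
    mul_pos hs (inv_pos.2 (aux_gp_pos (fun i => q i * γ i) γ hw _))
  have hpf : ∀ θ : ℝ, (∀ i, θ ≠ -γ i) → (∀ j, θ ≠ -δ j) →
        s / g θ = ∑ j, R j / (θ + δ j) := by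
    intro θ h1 h2
    have := aux_pf (s + c) (fun i => q i * γ i) γ hw δ hδord.injective
      (fun j => (hall j).1) (fun j => (hall j).2) θ
      (fun i h => h1 i (eq_neg_of_add_eq_zero_left h))
      (fun i h => h2 i (eq_neg_of_add_eq_zero_left h))
    rw [← hg'] at this
    rw [div_eq_mul_one_div, this, Finset.mul_sum]
    exact Finset.sum_congr rfl fun j _ => by rw [hR]; ring
  refine ⟨R, hRpos, hpf, ?_, ?_, ?_⟩
  · intro t
    exact Finset.sum_nonneg fun j _ => mul_nonneg (hRpos j).le (Real.exp_pos _).le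
  · intro θ hθ
    rw [hpf θ (fun i h => by linarith [hγ i]) (fun j h => by linarith [hδpos j])]
    have he : ∀ t : ℝ, Real.exp (-θ * t) * ∑ j, R j * Real.exp (-δ j * t)
        = ∑ j, R j * Real.exp (-(θ + δ j) * t) := by
      intro t
      rw [Finset.mul_sum]
      refine Finset.sum_congr rfl fun j _ => ?_
      rw [show -(θ + δ j) * t = -θ * t + -δ j * t by ring, Real.exp_add]; ring
    simp only [he]
    rw [integral_finsetSum]
    · refine Finset.sum_congr rfl fun j _ => ?_
      rw [integral_const_mul, integral_exp_mul_Ioi (by linarith [hδpos j])]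
      rw [mul_zero, Real.exp_zero, neg_div_neg_eq]
      ring
    · intro j _
      exact (integrableOn_exp_mul_Ioi (by linarith [hδpos j]) 0).const_mul _
  · intro k t _
    rw [iteratedDeriv_fun_sum (fun j _ => by fun_prop), Finset.mul_sum]
    refine Finset.sum_nonneg fun j _ => ?_
    rw [iteratedDeriv_const_mul_field, iteratedDeriv_exp_const_mul]
    have : (-1 : ℝ) ^ k * (R j * ((-δ j) ^ k * Real.exp (-δ j * t)))
        = R j * ((δ j) ^ k * Real.exp (-δ j * t)) := by
      rw [neg_pow (δ j) k]
      have : ((-1 : ℝ) ^ k) * (-1) ^ k = 1 := by rw [← mul_pow]; simp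
      linear_combination (R j * (δ j ^ k * Real.exp (-δ j * t))) * this
    simp only [this]
    have := hRpos j
    have := hδpos j
    positivity
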